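/- Let the dataset contain at least K distinct points and the communication graph be connected. Fix ρ > 0 and let x̆ be a global minimizer of Q^ρ (x̆ ∈ M^ρ_g). Then for every agent m, the K-tuple x̆_m = (x̆_m^1,…,x̆_m^K) satisfies F(x̆_m) ≤ F* + 16√M R₀² |D|² / (ρ λ₂(L)), where F* is the global minimum value of the K-means cost F, R₀ = max{‖v‖ : v ∈ closed convex hull of D}, and λ₂(L) > 0 is the second-smallest eigenvalue of the graph Laplacian L. -/

import Mathlib

open scoped BigOperators

noncomputable section

/-! ### Basic (centralized) K-means notions -/

/-- The dataset `D` contains at least `K` distinct points. -/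
def HasKDistinct {p : ℕ} (K : ℕ) (D : Multiset (EuclideanSpace ℝ (Fin p))) : Prop :=
  ∃ S : Finset (EuclideanSpace ℝ (Fin p)), S.card = K ∧ ∀ y ∈ S, y ∈ D

/-- The K-means clustering cost `F(x) = ∑_{y ∈ D} min_k ‖y - x^k‖²`. -/
def kmeansF {p : ℕ} (K : ℕ) (D : Multiset (EuclideanSpace ℝ (Fin p)))
    (x : Fin K → EuclideanSpace ℝ (Fin p)) : ℝ :=
  (D.map fun y => ⨅ k : Fin K, ‖y - x k‖ ^ 2).sum

/-- `P` is a partition of the multiset `D` into `K` (possibly empty) cells. -/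
def IsKPartition {p K : ℕ} (D : Multiset (EuclideanSpace ℝ (Fin p)))
    (P : Fin K → Multiset (EuclideanSpace ℝ (Fin p))) : Prop :=
  ∑ k, P k = D

/-- The distortion cost `H(x, P) = ∑_k ∑_{y ∈ P^k} ‖y - x^k‖²`. -/
def costH {p K : ℕ} (x : Fin K → EuclideanSpace ℝ (Fin p))
    (P : Fin K → Multiset (EuclideanSpace ℝ (Fin p))) : ℝ :=
  ∑ k, ((P k).map fun y => ‖y - x k‖ ^ 2).sum

/-- `(x, P)` is a Lloyd's minimum for the dataset `D`. -/
def IsLloydMin {p K : ℕ} (D : Multiset (EuclideanSpace ℝ (Fin p)))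
    (x : Fin K → EuclideanSpace ℝ (Fin p))
    (P : Fin K → Multiset (EuclideanSpace ℝ (Fin p))) : Prop :=
  IsKPartition D P ∧
    (∀ Q, IsKPartition D Q → costH x P ≤ costH x Q) ∧
    (∀ x', costH x P ≤ costH x' P)

/-- The set `Z` of Lloyd's minima (cluster-center tuples). -/
def LloydZ {p : ℕ} (K : ℕ) (D : Multiset (EuclideanSpace ℝ (Fin p))) :
    Set (Fin K → EuclideanSpace ℝ (Fin p)) :=
  {x | ∃ P, IsLloydMin D x P}

/-- The set `Z̄` of Lloyd's minima whose centers lie in the (closed) convex hull of `D`. -/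
def LloydZbar {p : ℕ} (K : ℕ) (D : Multiset (EuclideanSpace ℝ (Fin p))) :
    Set (Fin K → EuclideanSpace ℝ (Fin p)) :=
  {x ∈ LloydZ K D | ∀ k, x k ∈ convexHull ℝ {y | y ∈ D}}

/-- The set `Z_g` of global minimizers of the K-means cost `F`. -/
def kmeansZg {p : ℕ} (K : ℕ) (D : Multiset (EuclideanSpace ℝ (Fin p))) :
    Set (Fin K → EuclideanSpace ℝ (Fin p)) :=
  {x | ∀ x', kmeansF K D x ≤ kmeansF K D x'}

/-- The global minimum value `F*` of the K-means cost. -/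
def Fstar {p : ℕ} (K : ℕ) (D : Multiset (EuclideanSpace ℝ (Fin p))) : ℝ :=
  sInf (Set.range (kmeansF K D))

/-- `R₀ = max{‖v‖ : v ∈ closed convex hull of D}`. -/
def R0 {p : ℕ} (D : Multiset (EuclideanSpace ℝ (Fin p))) : ℝ :=
  sSup ((fun v => ‖v‖) '' convexHull ℝ {y | y ∈ D})

/-! ### Multi-agent notions -/

section Distributed

variable {p K M : ℕ}

/-- The multi-agent cost `J^ρ(x, C)`; each undirected edge is counted once in the
agreement term. -/
def costJ (ρ : ℝ) (G : SimpleGraph (Fin M)) [DecidableRel G.Adj]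
    (x : Fin M → Fin K → EuclideanSpace ℝ (Fin p))
    (C : Fin M → Fin K → Multiset (EuclideanSpace ℝ (Fin p))) : ℝ :=
  (1 / ρ) * ∑ m, ∑ k, ((C m k).map fun y => ‖y - x m k‖ ^ 2).sum +
    (1 / 2) * ∑ m, ∑ l ∈ G.neighborFinset m, ∑ k, ‖x m k - x l k‖ ^ 2

/-- The multi-agent cost `Q^ρ(x)`. -/
def costQ (ρ : ℝ) (G : SimpleGraph (Fin M)) [DecidableRel G.Adj]
    (Dm : Fin M → Multiset (EuclideanSpace ℝ (Fin p)))
    (x : Fin M → Fin K → EuclideanSpace ℝ (Fin p)) : ℝ :=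
  (1 / ρ) * ∑ m, ((Dm m).map fun y => ⨅ k : Fin K, ‖y - x m k‖ ^ 2).sum +
    (1 / 2) * ∑ m, ∑ l ∈ G.neighborFinset m, ∑ k, ‖x m k - x l k‖ ^ 2

/-- The set of global minimizers `M^ρ_g` of `Q^ρ`. -/
def globQ (ρ : ℝ) (G : SimpleGraph (Fin M)) [DecidableRel G.Adj]
    (Dm : Fin M → Multiset (EuclideanSpace ℝ (Fin p))) (K : ℕ) :
    Set (Fin M → Fin K → EuclideanSpace ℝ (Fin p)) :=
  {x | ∀ x' : Fin M → Fin K → EuclideanSpace ℝ (Fin p), costQ ρ G Dm x ≤ costQ ρ G Dm x'}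

/-- `C ∈ U_x` : `C` is an admissible (Voronoi / nearest-center) clustering for `x`. -/
def InVoronoi (Dm : Fin M → Multiset (EuclideanSpace ℝ (Fin p)))
    (x : Fin M → Fin K → EuclideanSpace ℝ (Fin p))
    (C : Fin M → Fin K → Multiset (EuclideanSpace ℝ (Fin p))) : Prop :=
  (∀ m, IsKPartition (Dm m) (C m)) ∧
    ∀ m k y, y ∈ C m k → ∀ k', ‖y - x m k‖ ≤ ‖y - x m k'‖

/-- The fixed-point (stationarity) equations
`((1/ρ)|C_m^k| + |Ω_m|) x_m^k = (1/ρ) ∑_{y ∈ C_m^k} y + ∑_{l ∈ Ω_m} x_l^k`. -/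
def IsFixedCenters (ρ : ℝ) (G : SimpleGraph (Fin M)) [DecidableRel G.Adj]
    (x : Fin M → Fin K → EuclideanSpace ℝ (Fin p))
    (C : Fin M → Fin K → Multiset (EuclideanSpace ℝ (Fin p))) : Prop :=
  ∀ m k, ((1 / ρ) * ((C m k).card : ℝ) + (G.degree m : ℝ)) • x m k =
      (1 / ρ) • (C m k).sum + ∑ l ∈ G.neighborFinset m, x l k

/-- `(x, C)` is a generalized Lloyd's minimum of `J^ρ`. -/
def IsGenLloydMin (ρ : ℝ) (G : SimpleGraph (Fin M)) [DecidableRel G.Adj]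
    (Dm : Fin M → Multiset (EuclideanSpace ℝ (Fin p)))
    (x : Fin M → Fin K → EuclideanSpace ℝ (Fin p))
    (C : Fin M → Fin K → Multiset (EuclideanSpace ℝ (Fin p))) : Prop :=
  InVoronoi Dm x C ∧ IsFixedCenters ρ G x C

/-- The set `M^ρ` of generalized Lloyd's minima (centers part). -/
def genM (ρ : ℝ) (G : SimpleGraph (Fin M)) [DecidableRel G.Adj]
    (Dm : Fin M → Multiset (EuclideanSpace ℝ (Fin p))) (K : ℕ) :
    Set (Fin M → Fin K → EuclideanSpace ℝ (Fin p)) :=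
  {x | ∃ C, IsGenLloydMin ρ G Dm x C}

/-- The set `M̄^ρ` of generalized Lloyd's minima with all centers in the (closed)
convex hull of the collective dataset `D`. -/
def genMbar (ρ : ℝ) (G : SimpleGraph (Fin M)) [DecidableRel G.Adj]
    (Dm : Fin M → Multiset (EuclideanSpace ℝ (Fin p)))
    (D : Multiset (EuclideanSpace ℝ (Fin p))) (K : ℕ) :
    Set (Fin M → Fin K → EuclideanSpace ℝ (Fin p)) :=
  {x ∈ genM ρ G Dm K | ∀ m k, x m k ∈ convexHull ℝ {y | y ∈ D}}

/-- The update target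
`μ_m^k = ((1/ρ) ∑_{y ∈ C_m^k} y + ∑_{l ∈ Ω_m} x_l^k) / ((1/ρ)|C_m^k| + |Ω_m|)`. -/
def muVec (ρ : ℝ) (G : SimpleGraph (Fin M)) [DecidableRel G.Adj]
    (x : Fin M → Fin K → EuclideanSpace ℝ (Fin p))
    (C : Fin M → Fin K → Multiset (EuclideanSpace ℝ (Fin p)))
    (m : Fin M) (k : Fin K) : EuclideanSpace ℝ (Fin p) :=
  ((1 / ρ) * ((C m k).card : ℝ) + (G.degree m : ℝ))⁻¹ •
    ((1 / ρ) • (C m k).sum + ∑ l ∈ G.neighborFinset m, x l k)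

/-- `(x_t, C_t)` is a trajectory of the NK-means algorithm with parameters `ρ, α`. -/
def NKMeansSeq (ρ α : ℝ) (G : SimpleGraph (Fin M)) [DecidableRel G.Adj]
    (Dm : Fin M → Multiset (EuclideanSpace ℝ (Fin p)))
    (x : ℕ → Fin M → Fin K → EuclideanSpace ℝ (Fin p))
    (C : ℕ → Fin M → Fin K → Multiset (EuclideanSpace ℝ (Fin p))) : Prop :=
  (∀ m, IsKPartition (Dm m) (C 0 m)) ∧
    ∀ t, (∀ m, IsKPartition (Dm m) (C (t + 1) m)) ∧
      (∀ m k y, y ∈ C (t + 1) m k → ∀ k', ‖y - x t m k‖ ≤ ‖y - x t m k'‖) ∧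
      ∀ m k, x (t + 1) m k = x t m k - α • (x t m k - muVec ρ G (x t) (C (t + 1)) m k)

/-- The minimum vertex degree `d_min` of the communication graph. -/
def minDeg (G : SimpleGraph (Fin M)) [DecidableRel G.Adj] : ℕ :=
  sInf (Set.range fun m : Fin M => G.degree m)

/-- The largest eigenvalue `λ_M(L)` of the graph Laplacian. -/
def lapLamMax (G : SimpleGraph (Fin M)) [DecidableRel G.Adj] : ℝ :=
  sSup (spectrum ℝ (G.lapMatrix ℝ))

/-- The second-smallest eigenvalue `λ₂(L)` of the graph Laplacian (for a connected
graph, the smallest nonzero eigenvalue). -/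
def lapLam2 (G : SimpleGraph (Fin M)) [DecidableRel G.Adj] : ℝ :=
  sInf {μ : ℝ | μ ∈ spectrum ℝ (G.lapMatrix ℝ) ∧ μ ≠ 0}

/-- `N* = max_m |D_m|`. -/
def Nstar (Dm : Fin M → Multiset (EuclideanSpace ℝ (Fin p))) : ℕ :=
  Finset.univ.sup fun m => (Dm m).card

/-- The step-size condition `0 < α < d_min / ((1/ρ) N* + λ_M(L))`. -/
def StepOK (ρ α : ℝ) (G : SimpleGraph (Fin M)) [DecidableRel G.Adj]
    (Dm : Fin M → Multiset (EuclideanSpace ℝ (Fin p))) : Prop :=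
  0 < α ∧ α * ((1 / ρ) * (Nstar Dm : ℝ) + lapLamMax G) < (minDeg G : ℝ)

/-- The constant `c(α) = 2α(d_min − α((1/ρ)N* + λ_M(L)))`. -/
def cAlpha (ρ α : ℝ) (G : SimpleGraph (Fin M)) [DecidableRel G.Adj]
    (Dm : Fin M → Multiset (EuclideanSpace ℝ (Fin p))) : ℝ :=
  2 * α * ((minDeg G : ℝ) - α * ((1 / ρ) * (Nstar Dm : ℝ) + lapLamMax G))

end Distributed

/-! ### The Poincaré inequality on a connected graph -/

section Laplacian

open Matrix

variable {M : ℕ} (G : SimpleGraph (Fin M)) [DecidableRel G.Adj]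

lemma lapMatrix_spectrum_nonneg {μ : ℝ} (hμ : μ ∈ spectrum ℝ (G.lapMatrix ℝ)) : 0 ≤ μ := by
  have hpsd := G.posSemidef_lapMatrix ℝ
  rw [hpsd.isHermitian.spectrum_real_eq_range_eigenvalues] at hμ
  obtain ⟨i, rfl⟩ := hμ
  exact hpsd.eigenvalues_nonneg i

lemma lapLam2_le {μ : ℝ} (hμ : μ ∈ spectrum ℝ (G.lapMatrix ℝ)) (h0 : μ ≠ 0) :
    lapLam2 G ≤ μ :=
  csInf_le ⟨0, fun _ hν => lapMatrix_spectrum_nonneg G hν.1⟩ ⟨hμ, h0⟩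

variable {G}

lemma lapLam2_pos [Nontrivial (Fin M)] (hconn : G.Connected) : 0 < lapLam2 G := by
  have hA := (G.posSemidef_lapMatrix ℝ).isHermitian
  have hne : {μ : ℝ | μ ∈ spectrum ℝ (G.lapMatrix ℝ) ∧ μ ≠ 0}.Nonempty := by
    by_contra hempty
    have hzero : G.lapMatrix ℝ = 0 := by
      rw [← hA.eigenvalues_eq_zero_iff]
      funext i
      by_contra hi
      exact hempty ⟨_, hA.eigenvalues_mem_spectrum_real i, hi⟩
    obtain ⟨i, j, hij⟩ := exists_pair_ne (Fin M)
    have hconst : ∀ a b : Fin M, G.Reachable a b →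
        (Pi.single i 1 : Fin M → ℝ) a = (Pi.single i 1 : Fin M → ℝ) b := by
      rw [← G.lapMatrix_mulVec_eq_zero_iff_forall_reachable, hzero, zero_mulVec]
    have := hconst i j (hconn.preconnected i j)
    simp [hij.symm] at this
  have hfin : {μ : ℝ | μ ∈ spectrum ℝ (G.lapMatrix ℝ) ∧ μ ≠ 0}.Finite :=
    (finite_real_spectrum (A := G.lapMatrix ℝ)).subset fun _ h => h.1
  have hmem := hne.csInf_mem hfin
  exact lt_of_le_of_ne (lapMatrix_spectrum_nonneg G hmem.1) (Ne.symm hmem.2)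

lemma lapLam2_mul_sum_sq_le_dotProduct (hconn : G.Connected) {w : Fin M → ℝ}
    (hw : ∑ i, w i = 0) :
    lapLam2 G * ∑ i, w i ^ 2 ≤ w ⬝ᵥ (G.lapMatrix ℝ *ᵥ w) := by
  have hA := (G.posSemidef_lapMatrix ℝ).isHermitian
  set b := hA.eigenvectorBasis
  have hinner (u v : Fin M → ℝ) :
      u ⬝ᵥ v = ∑ i, (u ⬝ᵥ ⇑(b i)) * (⇑(b i) ⬝ᵥ v) := by
    have h := b.sum_inner_mul_inner (WithLp.toLp 2 u) (WithLp.toLp 2 v)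
    simp only [EuclideanSpace.inner_eq_star_dotProduct, star_trivial] at h
    rw [dotProduct_comm, ← h]
    refine Finset.sum_congr rfl fun i _ => ?_
    rw [dotProduct_comm u, dotProduct_comm v]
  have heig (i : Fin M) :
      ⇑(b i) ⬝ᵥ (G.lapMatrix ℝ *ᵥ w) = hA.eigenvalues i * (⇑(b i) ⬝ᵥ w) := by
    rw [dotProduct_mulVec, ← mulVec_transpose, (G.isSymm_lapMatrix ℝ).eq,
      hA.mulVec_eigenvectorBasis, smul_dotProduct, smul_eq_mul]
  have hsq : ∑ i, w i ^ 2 = w ⬝ᵥ w := by simp [dotProduct, sq]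
  rw [hsq, hinner w w, hinner w (G.lapMatrix ℝ *ᵥ w), Finset.mul_sum]
  refine Finset.sum_le_sum fun i _ => ?_
  rw [heig, dotProduct_comm w]
  by_cases hi : hA.eigenvalues i = 0
  · have hconst : ∀ k l : Fin M, (b i) k = (b i) l := fun k l => by
      refine (G.lapMatrix_mulVec_eq_zero_iff_forall_reachable (x := ⇑(b i))).1 ?_ k l
        (hconn.preconnected k l)
      rw [hA.mulVec_eigenvectorBasis, hi, zero_smul]
    have hzero : ⇑(b i) ⬝ᵥ w = 0 := by
      rw [dotProduct, Finset.sum_congr rfl fun k _ => by rw [hconst k i], ← Finset.mul_sum, hw,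
        mul_zero]
    simp [hzero]
  · nlinarith [lapLam2_le G (hA.eigenvalues_mem_spectrum_real i) hi, sq_nonneg (⇑(b i) ⬝ᵥ w)]

end Laplacian

section Dirichlet

variable {p K M : ℕ} (G : SimpleGraph (Fin M)) [DecidableRel G.Adj]

/-- The agreement term of `costQ`, each undirected edge being counted once. -/
def dirichletEnergy (x : Fin M → Fin K → EuclideanSpace ℝ (Fin p)) : ℝ :=
  (1 / 2) * ∑ m, ∑ l ∈ G.neighborFinset m, ∑ k, ‖x m k - x l k‖ ^ 2

variable {G}

lemma lapLam2_mul_sum_norm_sq_le_dirichletEnergy (hconn : G.Connected)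
    (x : Fin M → Fin K → EuclideanSpace ℝ (Fin p)) {c : Fin K → EuclideanSpace ℝ (Fin p)}
    (hc : ∀ k, ∑ m, (x m k - c k) = 0) :
    lapLam2 G * ∑ m, ∑ k, ‖x m k - c k‖ ^ 2 ≤ dirichletEnergy G x := by
  have hcoord (k : Fin K) (i : Fin p) :
      lapLam2 G * ∑ m, ((x m k - c k) i) ^ 2 ≤
        (1 / 2) * ∑ m, ∑ l ∈ G.neighborFinset m, ((x m k - x l k) i) ^ 2 := by
    have hsum : ∑ m, (x m k - c k) i = 0 := by
      simpa using congrArg (fun v : EuclideanSpace ℝ (Fin p) => v i) (hc k)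
    refine (lapLam2_mul_sum_sq_le_dotProduct hconn hsum).trans_eq ?_
    rw [← Matrix.toLinearMap₂'_apply', G.lapMatrix_toLinearMap₂' ℝ, div_eq_inv_mul, one_div]
    congr 1
    refine Finset.sum_congr rfl fun m _ => ?_
    rw [← Finset.sum_filter, ← SimpleGraph.neighborFinset_eq_filter]
    refine Finset.sum_congr rfl fun l _ => ?_
    simp
  calc lapLam2 G * ∑ m, ∑ k, ‖x m k - c k‖ ^ 2
      = ∑ k, ∑ i, lapLam2 G * ∑ m, ((x m k - c k) i) ^ 2 := by
        simp_rw [← Finset.mul_sum, EuclideanSpace.real_norm_sq_eq]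
        rw [Finset.sum_comm]
        congr 1
        exact Finset.sum_congr rfl fun k _ => Finset.sum_comm
    _ ≤ ∑ k, ∑ i, (1 / 2) * ∑ m, ∑ l ∈ G.neighborFinset m, ((x m k - x l k) i) ^ 2 :=
        Finset.sum_le_sum fun k _ => Finset.sum_le_sum fun i _ => hcoord k i
    _ = dirichletEnergy G x := by
        simp_rw [dirichletEnergy, ← Finset.mul_sum, EuclideanSpace.real_norm_sq_eq]
        congr 1
        rw [Finset.sum_congr rfl fun k _ => Finset.sum_comm, Finset.sum_comm]
        refine Finset.sum_congr rfl fun m _ => ?_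
        rw [Finset.sum_congr rfl fun k _ => Finset.sum_comm, Finset.sum_comm]

lemma eq_of_dirichletEnergy_nonpos (hconn : G.Connected)
    {x : Fin M → Fin K → EuclideanSpace ℝ (Fin p)} (hx : dirichletEnergy G x ≤ 0)
    (m l : Fin M) (k : Fin K) : x m k = x l k := by
  have hadj {a b : Fin M} (hab : G.Adj a b) : x a k = x b k := by
    have h₁ : ‖x a k - x b k‖ ^ 2 ≤ ∑ k, ‖x a k - x b k‖ ^ 2 :=
      Finset.single_le_sum (f := fun k => ‖x a k - x b k‖ ^ 2)
        (fun _ _ => sq_nonneg _) (Finset.mem_univ k)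
    have h₂ : ∑ k, ‖x a k - x b k‖ ^ 2 ≤ ∑ l ∈ G.neighborFinset a, ∑ k, ‖x a k - x l k‖ ^ 2 :=
      Finset.single_le_sum (f := fun l => ∑ k, ‖x a k - x l k‖ ^ 2)
        (fun _ _ => Finset.sum_nonneg fun _ _ => sq_nonneg _)
        ((G.mem_neighborFinset a b).2 hab)
    have h₃ : ∑ l ∈ G.neighborFinset a, ∑ k, ‖x a k - x l k‖ ^ 2 ≤
        ∑ m, ∑ l ∈ G.neighborFinset m, ∑ k, ‖x m k - x l k‖ ^ 2 :=
      Finset.single_le_sum (f := fun m => ∑ l ∈ G.neighborFinset m, ∑ k, ‖x m k - x l k‖ ^ 2)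
        (fun _ _ => Finset.sum_nonneg fun _ _ => Finset.sum_nonneg fun _ _ => sq_nonneg _)
        (Finset.mem_univ a)
    have h₄ : ‖x a k - x b k‖ ^ 2 ≤ 0 := by unfold dirichletEnergy at hx; linarith
    have h₅ : ‖x a k - x b k‖ = 0 := pow_eq_zero_iff two_ne_zero |>.1 (h₄.antisymm (by positivity))
    exact sub_eq_zero.1 (norm_eq_zero.1 h₅)
  obtain ⟨w⟩ := hconn.preconnected m l
  induction w with
  | nil => rfl
  | cons h _ ih => exact (hadj h).trans ih

lemma dirichletEnergy_nonneg (x : Fin M → Fin K → EuclideanSpace ℝ (Fin p)) :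
    0 ≤ dirichletEnergy G x := by
  unfold dirichletEnergy
  positivity

lemma dirichletEnergy_add_le {x u v : Fin M → Fin K → EuclideanSpace ℝ (Fin p)}
    (h : ∀ m l k, ‖u m k - u l k‖ ^ 2 + ‖v m k - v l k‖ ^ 2 ≤ ‖x m k - x l k‖ ^ 2) :
    dirichletEnergy G u + dirichletEnergy G v ≤ dirichletEnergy G x := by
  simp only [dirichletEnergy, ← mul_add, ← Finset.sum_add_distrib]
  gcongr
  exact h _ _ _

lemma dirichletEnergy_const (z : Fin K → EuclideanSpace ℝ (Fin p)) :
    dirichletEnergy G (fun _ => z) = 0 := by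
  simp [dirichletEnergy]

lemma dirichletEnergy_contract (x : Fin M → Fin K → EuclideanSpace ℝ (Fin p))
    (c : Fin K → EuclideanSpace ℝ (Fin p)) (t : ℝ) :
    dirichletEnergy G (fun m k => x m k + t • (c k - x m k)) =
      (1 - t) ^ 2 * dirichletEnergy G x := by
  have h (m l : Fin M) (k : Fin K) :
      ‖x m k + t • (c k - x m k) - (x l k + t • (c k - x l k))‖ ^ 2 =
        (1 - t) ^ 2 * ‖x m k - x l k‖ ^ 2 := by
    rw [show x m k + t • (c k - x m k) - (x l k + t • (c k - x l k)) =
      (1 - t) • (x m k - x l k) by module, norm_smul, mul_pow, Real.norm_eq_abs, sq_abs]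
  simp only [dirichletEnergy, h, ← Finset.mul_sum]
  ring

end Dirichlet

/-! ### Sums over the local datasets -/

section AgentSum

variable {α : Type*} {M : ℕ}

/-- The sum of `f m y` over all agents `m` and all local data points `y`. -/
def agentSum (Dm : Fin M → Multiset α) (f : Fin M → α → ℝ) : ℝ :=
  ∑ m, ((Dm m).map (f m)).sum

variable {Dm : Fin M → Multiset α} {f g : Fin M → α → ℝ}

lemma agentSum_le_agentSum (h : ∀ m, ∀ y ∈ Dm m, f m y ≤ g m y) :
    agentSum Dm f ≤ agentSum Dm g :=
  Finset.sum_le_sum fun m _ => Multiset.sum_map_le_sum_map _ _ (h m)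

lemma agentSum_add :
    agentSum Dm (fun m y => f m y + g m y) = agentSum Dm f + agentSum Dm g := by
  simp [agentSum, Multiset.sum_map_add, Finset.sum_add_distrib]

lemma agentSum_const (c : ℝ) :
    agentSum Dm (fun _ _ => c) = ((∑ m, Dm m).card : ℝ) * c := by
  simp [agentSum, Finset.sum_mul]

lemma sum_map_eq_agentSum (f : α → ℝ) :
    ((∑ m, Dm m).map f).sum = agentSum Dm (fun _ => f) :=
  map_sum (Multiset.sumAddMonoidHom.comp (Multiset.mapAddMonoidHom f)) Dm Finset.univ

lemma agentSum_nonneg (h : ∀ m y, 0 ≤ f m y) : 0 ≤ agentSum Dm f :=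
  Finset.sum_nonneg fun m _ => Multiset.sum_nonneg fun a ha => by
    obtain ⟨y, -, rfl⟩ := Multiset.mem_map.1 ha
    exact h m y

lemma le_agentSum (h : ∀ m y, 0 ≤ f m y) {m : Fin M} {y : α} (hy : y ∈ Dm m) :
    f m y ≤ agentSum Dm f := by
  have hnonneg (l : Fin M) : ∀ a ∈ (Dm l).map (f l), 0 ≤ a := fun a ha => by
    obtain ⟨y, -, rfl⟩ := Multiset.mem_map.1 ha
    exact h l y
  exact (Multiset.single_le_sum (hnonneg m) _ (Multiset.mem_map_of_mem _ hy)).trans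
    (Finset.single_le_sum (f := fun l => ((Dm l).map (f l)).sum)
      (fun l _ => Multiset.sum_nonneg (hnonneg l)) (Finset.mem_univ m))

end AgentSum

/-! ### Projection onto a centered ball -/

lemma norm_le_R0 {p : ℕ} {D : Multiset (EuclideanSpace ℝ (Fin p))}
    {y : EuclideanSpace ℝ (Fin p)} (hy : y ∈ D) : ‖y‖ ≤ R0 D := by
  have hfin : {y | y ∈ D}.Finite := Multiset.finite_toSet D
  exact le_csSup ((hfin.isCompact_convexHull ℝ).image continuous_norm).bddAbove
    ⟨y, subset_convexHull ℝ _ hy, rfl⟩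

lemma R0_nonneg {p : ℕ} (D : Multiset (EuclideanSpace ℝ (Fin p))) : 0 ≤ R0 D := by
  refine Real.sSup_nonneg ?_
  rintro _ ⟨v, -, rfl⟩
  exact norm_nonneg v

lemma exists_firmly_nonexpansive_projection {V : Type*} [NormedAddCommGroup V]
    [InnerProductSpace ℝ V] [CompleteSpace V] {R : ℝ} (hR : 0 ≤ R) :
    ∃ P : V → V, (∀ v, ‖P v‖ ≤ R) ∧
      (∀ w v, ‖w‖ ≤ R → ‖w - P v‖ ^ 2 + ‖v - P v‖ ^ 2 ≤ ‖w - v‖ ^ 2) ∧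
      ∀ u v, ‖P u - P v‖ ^ 2 + ‖(u - P u) - (v - P v)‖ ^ 2 ≤ ‖u - v‖ ^ 2 := by
  have hconv : Convex ℝ (Metric.closedBall (0 : V) R) := convex_closedBall 0 R
  choose P hP hmin using exists_norm_eq_iInf_of_complete_convex (F := V)
    (K := Metric.closedBall (0 : V) R) ⟨0, by simpa using hR⟩
    Metric.isClosed_closedBall.isComplete hconv
  have hproj (v w : V) (hw : ‖w‖ ≤ R) : inner ℝ (v - P v) (w - P v) ≤ 0 :=
    (norm_eq_iInf_iff_real_inner_le_zero hconv (hP v)).1 (hmin v) w (by simpa using hw)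
  have hPR (v : V) : ‖P v‖ ≤ R := by simpa using hP v
  refine ⟨P, hPR, fun w v hw => ?_, fun u v => ?_⟩
  · have h := norm_sub_sq_real (w - P v) (v - P v)
    rw [sub_sub_sub_cancel_right, real_inner_comm] at h
    linarith [hproj v w hw]
  · have h := norm_add_sq_real (P u - P v) ((u - P u) - (v - P v))
    rw [show P u - P v + ((u - P u) - (v - P v)) = u - v by abel, inner_sub_right,
      real_inner_comm, real_inner_comm (v - P v)] at h
    have h₁ := hproj u (P v) (hPR v)
    have h₂ := hproj v (P u) (hPR u)
    rw [← neg_sub (P u) (P v), inner_neg_right] at h₁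
    linarith

/-! ### Global minimizers of `costQ` -/

section Minimizer

variable {p K M : ℕ} {ρ : ℝ} {G : SimpleGraph (Fin M)} [DecidableRel G.Adj]
  {Dm : Fin M → Multiset (EuclideanSpace ℝ (Fin p))}
  {x : Fin M → Fin K → EuclideanSpace ℝ (Fin p)}
  {j : Fin M → EuclideanSpace ℝ (Fin p) → Fin K}

/-- The total clustering cost when agent `m` assigns the data point `y` to its center `j m y`. -/
def assignedCost (Dm : Fin M → Multiset (EuclideanSpace ℝ (Fin p)))
    (j : Fin M → EuclideanSpace ℝ (Fin p) → Fin K)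
    (x : Fin M → Fin K → EuclideanSpace ℝ (Fin p)) : ℝ :=
  agentSum Dm fun m y => ‖y - x m (j m y)‖ ^ 2

/-- The smooth surrogate of `costQ` obtained by freezing the assignment `j`. -/
def assignedQ (ρ : ℝ) (G : SimpleGraph (Fin M)) [DecidableRel G.Adj]
    (Dm : Fin M → Multiset (EuclideanSpace ℝ (Fin p)))
    (j : Fin M → EuclideanSpace ℝ (Fin p) → Fin K)
    (x : Fin M → Fin K → EuclideanSpace ℝ (Fin p)) : ℝ :=
  (1 / ρ) * assignedCost Dm j x + dirichletEnergy G x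

lemma iInf_norm_sq_le (y : EuclideanSpace ℝ (Fin p))
    (z : Fin K → EuclideanSpace ℝ (Fin p)) (k : Fin K) :
    ⨅ k, ‖y - z k‖ ^ 2 ≤ ‖y - z k‖ ^ 2 :=
  ciInf_le (Set.finite_range _).bddBelow k

lemma costQ_le_assignedQ (hρ : 0 < ρ) (j : Fin M → EuclideanSpace ℝ (Fin p) → Fin K)
    (x : Fin M → Fin K → EuclideanSpace ℝ (Fin p)) :
    costQ ρ G Dm x ≤ assignedQ ρ G Dm j x := by
  have h : agentSum Dm (fun m y => ⨅ k, ‖y - x m k‖ ^ 2) ≤ assignedCost Dm j x :=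
    agentSum_le_agentSum fun m y _ => iInf_norm_sq_le y (x m) (j m y)
  exact add_le_add_left (mul_le_mul_of_nonneg_left h (by positivity)) _

lemma exists_assignment_costQ_eq [Nonempty (Fin K)]
    (x : Fin M → Fin K → EuclideanSpace ℝ (Fin p)) :
    ∃ j : Fin M → EuclideanSpace ℝ (Fin p) → Fin K,
      costQ ρ G Dm x = assignedQ ρ G Dm j x := by
  choose j hj using fun (m : Fin M) (y : EuclideanSpace ℝ (Fin p)) =>
    exists_eq_ciInf_of_finite (f := fun k : Fin K => ‖y - x m k‖ ^ 2)
  exact ⟨j, by simp only [costQ, assignedQ, assignedCost, agentSum, dirichletEnergy, hj]⟩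

lemma costQ_const (z : Fin K → EuclideanSpace ℝ (Fin p)) :
    costQ ρ G Dm (fun _ => z) = (1 / ρ) * kmeansF K (∑ m, Dm m) z := by
  rw [kmeansF, sum_map_eq_agentSum]
  simp [costQ, agentSum]

/-- Centers to which some agent assigns a data point lie, for all agents, in every centered ball
that contains the data. -/
lemma norm_assigned_center_le (hρ : 0 < ρ) (hconn : G.Connected)
    (hmin : ∀ x', assignedQ ρ G Dm j x ≤ assignedQ ρ G Dm j x') {R : ℝ} (hR : 0 ≤ R)
    (hdata : ∀ m, ∀ y ∈ Dm m, ‖y‖ ≤ R) {m : Fin M} {y : EuclideanSpace ℝ (Fin p)}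
    (hy : y ∈ Dm m) (l : Fin M) : ‖x l (j m y)‖ ≤ R := by
  obtain ⟨P, hPR, hPdata, hPfirm⟩ :=
    exists_firmly_nonexpansive_projection (V := EuclideanSpace ℝ (Fin p)) hR
  set r : Fin M → Fin K → EuclideanSpace ℝ (Fin p) := fun m k => x m k - P (x m k) with hr
  set A := agentSum Dm fun m y => ‖r m (j m y)‖ ^ 2 with hA
  have hcost : assignedCost Dm j (fun m k => P (x m k)) + A ≤ assignedCost Dm j x := by
    rw [assignedCost, hA, ← agentSum_add]
    exact agentSum_le_agentSum fun m y hy => hPdata y _ (hdata m y hy)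
  have henergy : dirichletEnergy G (fun m k => P (x m k)) + dirichletEnergy G r ≤
      dirichletEnergy G x := dirichletEnergy_add_le fun _ _ _ => hPfirm _ _
  have hle := hmin fun m k => P (x m k)
  unfold assignedQ at hle
  have hcost' := mul_le_mul_of_nonneg_left hcost (one_div_pos.2 hρ).le
  have hA0 : 0 ≤ A := agentSum_nonneg fun _ _ => by positivity
  have hA0' : 0 ≤ 1 / ρ * A := by positivity
  have hr0 : 0 ≤ dirichletEnergy G r := dirichletEnergy_nonneg r
  rw [mul_add] at hcost'
  have hAle : A ≤ 0 := nonpos_of_mul_nonpos_right (by linarith) (one_div_pos.2 hρ)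
  have hterm : ‖r m (j m y)‖ ^ 2 ≤ A :=
    le_agentSum (f := fun m y => ‖r m (j m y)‖ ^ 2) (fun _ _ => by positivity) hy
  have hrm : r m (j m y) = 0 := by
    rw [← norm_eq_zero, ← pow_eq_zero_iff two_ne_zero]
    exact (hterm.trans hAle).antisymm (by positivity)
  have hrl : r l (j m y) = 0 :=
    (eq_of_dirichletEnergy_nonpos hconn (by linarith) l m (j m y)).trans hrm
  rw [sub_eq_zero.1 hrl]
  exact hPR _

lemma le_of_forall_le_add_mul {a b c : ℝ} (h : ∀ t : ℝ, 0 < t → a ≤ b + t * c) : a ≤ b := by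
  have hlim : Filter.Tendsto (fun t : ℝ => b + t * c) (nhdsWithin 0 (Set.Ioi 0)) (nhds b) := by
    have : Continuous fun t : ℝ => b + t * c := by fun_prop
    simpa using (this.tendsto 0).mono_left nhdsWithin_le_nhds
  exact ge_of_tendsto hlim (by filter_upwards [self_mem_nhdsWithin] with t ht using h t ht)

/-- First-order optimality of the minimizer along the segment towards a consensus tuple `c`. -/
lemma dirichletEnergy_mul_le (hρ : 0 < ρ)
    (hmin : ∀ x', assignedQ ρ G Dm j x ≤ assignedQ ρ G Dm j x') {R S : ℝ} (hR : 0 ≤ R)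
    (hdata : ∀ m, ∀ y ∈ Dm m, ‖y - x m (j m y)‖ ≤ 2 * R)
    {c : Fin K → EuclideanSpace ℝ (Fin p)} (hS : ∀ m k, ‖x m k - c k‖ ≤ S) :
    dirichletEnergy G x * ρ ≤ 2 * R * (∑ m, Dm m).card * S := by
  set N : ℝ := ((∑ m, Dm m).card : ℝ) with hN
  set E := dirichletEnergy G x with hE
  refine le_of_forall_le_add_mul (c := (N * S ^ 2 + E * ρ) / 2) fun t ht => ?_
  have hcost : assignedCost Dm j (fun m k => x m k + t • (c k - x m k)) ≤
      assignedCost Dm j x + N * (4 * t * R * S + t ^ 2 * S ^ 2) := by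
    rw [assignedCost, assignedCost, ← agentSum_const, ← agentSum_add]
    refine agentSum_le_agentSum fun m y hy => ?_
    set a := y - x m (j m y) with ha
    set d := x m (j m y) - c (j m y) with hd
    rw [show y - (x m (j m y) + t • (c (j m y) - x m (j m y))) = a + t • d by
      rw [ha, hd]; module]
    have h₁ : ‖a + t • d‖ ≤ ‖a‖ + t * ‖d‖ := by
      simpa [norm_smul, abs_of_pos ht] using norm_add_le a (t • d)
    have h₂ : ‖a‖ ≤ 2 * R := hdata m y hy
    have h₃ : ‖d‖ ≤ S := hS _ _
    have h₄ : ‖a‖ * ‖d‖ ≤ 2 * R * S := by gcongr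
    have h₅ : ‖d‖ ^ 2 ≤ S ^ 2 := by gcongr
    calc ‖a + t • d‖ ^ 2 ≤ (‖a‖ + t * ‖d‖) ^ 2 := by gcongr
      _ = ‖a‖ ^ 2 + (2 * t * (‖a‖ * ‖d‖) + t ^ 2 * ‖d‖ ^ 2) := by ring
      _ ≤ ‖a‖ ^ 2 + (2 * t * (2 * R * S) + t ^ 2 * S ^ 2) := by gcongr
      _ = ‖a‖ ^ 2 + (4 * t * R * S + t ^ 2 * S ^ 2) := by ring
  have hle := hmin fun m k => x m k + t • (c k - x m k)
  rw [assignedQ, assignedQ, dirichletEnergy_contract, ← hE] at hle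
  have hle' := mul_le_mul_of_nonneg_left hle hρ.le
  rw [mul_add, mul_add, ← mul_assoc, ← mul_assoc, mul_one_div_cancel hρ.ne', one_mul,
    one_mul] at hle'
  have hmul : t * (E * ρ) ≤ t * (2 * R * N * S + t * ((N * S ^ 2 + E * ρ) / 2)) := by
    linarith
  exact le_of_mul_le_mul_left hmul ht

/-- The optimality gap of every agent is controlled by the distance to consensus. -/
lemma kmeansF_le_of_forall_norm_sub_le (hρ : 0 < ρ) (hQ : costQ ρ G Dm x = assignedQ ρ G Dm j x)
    (hx : x ∈ globQ ρ G Dm K) {R δ : ℝ}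
    (hdata : ∀ m, ∀ y ∈ Dm m, ‖y‖ ≤ R)
    (hcenter : ∀ m, ∀ y ∈ Dm m, ∀ l, ‖x l (j m y)‖ ≤ R)
    (m : Fin M) (hδ : ∀ l k, ‖x l k - x m k‖ ≤ δ) :
    kmeansF K (∑ m, Dm m) (x m) ≤
      Fstar K (∑ m, Dm m) + 4 * R * δ * (∑ m, Dm m).card := by
  have hstar : assignedCost Dm j x ≤ Fstar K (∑ m, Dm m) := by
    refine le_csInf (Set.range_nonempty _) ?_
    rintro _ ⟨z, rfl⟩
    have hz := hx fun _ => z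
    rw [costQ_const, hQ, assignedQ] at hz
    have hE := dirichletEnergy_nonneg (G := G) x
    exact le_of_mul_le_mul_left (by linarith) (one_div_pos.2 hρ)
  refine le_trans ?_ (add_le_add_left hstar _)
  rw [kmeansF, sum_map_eq_agentSum, assignedCost, mul_comm (4 * R * δ), ← agentSum_const,
    ← agentSum_add]
  refine agentSum_le_agentSum fun l y hy => (iInf_norm_sq_le y (x m) (j l y)).trans ?_
  set a := y - x m (j l y) with ha
  set b := y - x l (j l y) with hb
  have h₁ : ‖a‖ ≤ 2 * R := by
    linarith [norm_sub_le y (x m (j l y)), hdata l y hy, hcenter l y hy m]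
  have h₂ : ‖b‖ ≤ 2 * R := by
    linarith [norm_sub_le y (x l (j l y)), hdata l y hy, hcenter l y hy l]
  have h₃ : ‖a‖ - ‖b‖ ≤ δ := by
    refine (norm_sub_norm_le a b).trans ?_
    rw [ha, hb, sub_sub_sub_cancel_left]
    exact hδ l _
  have hδ0 : 0 ≤ δ := (norm_nonneg _).trans (hδ l (j l y))
  have hab0 : 0 ≤ ‖a‖ + ‖b‖ := by positivity
  nlinarith [mul_le_mul_of_nonneg_right h₃ hab0,
    mul_le_mul_of_nonneg_left (add_le_add h₁ h₂) hδ0]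

end Minimizer

/-- Lemma 9, optimality gap: for any global minimizer `x̆` of `Q^ρ`
and every agent `m`, `F(x̆_m) ≤ F* + 16√M R₀² |D|² / (ρ λ₂(L))`. -/
theorem stmt19 {p K M : ℕ} (hK2 : 2 ≤ K)
    (Dm : Fin M → Multiset (EuclideanSpace ℝ (Fin p)))
    (D : Multiset (EuclideanSpace ℝ (Fin p))) (hD : ∑ m, Dm m = D)
    (hdistinct : HasKDistinct K D)
    (G : SimpleGraph (Fin M)) [DecidableRel G.Adj] (hconn : G.Connected)
    (ρ : ℝ) (hρ : 0 < ρ)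
    (x : Fin M → Fin K → EuclideanSpace ℝ (Fin p))
    (hx : x ∈ globQ ρ G Dm K) :
    ∀ m : Fin M,
      kmeansF K D (x m) ≤ Fstar K D +
        16 * Real.sqrt M * R0 D ^ 2 * (Multiset.card D : ℝ) ^ 2 / (ρ * lapLam2 G) := by
  subst hD
  intro m
  have : NeZero K := ⟨by omega⟩
  obtain ⟨j, hQ⟩ := exists_assignment_costQ_eq (ρ := ρ) (G := G) (Dm := Dm) x
  have hmin : ∀ x', assignedQ ρ G Dm j x ≤ assignedQ ρ G Dm j x' := fun x' =>
    hQ.symm.le.trans ((hx x').trans (costQ_le_assignedQ hρ j x'))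
  set R := R0 (∑ m, Dm m) with hRdef
  set N : ℝ := ((∑ m, Dm m).card : ℝ) with hN
  have hR : 0 ≤ R := R0_nonneg _
  have hdata : ∀ m, ∀ y ∈ Dm m, ‖y‖ ≤ R := fun m y hy =>
    norm_le_R0 (Multiset.mem_sum.2 ⟨m, Finset.mem_univ m, hy⟩)
  have hcenter : ∀ m, ∀ y ∈ Dm m, ∀ l, ‖x l (j m y)‖ ≤ R := fun m y hy l =>
    norm_assigned_center_le hρ hconn hmin hR hdata hy l
  rcases subsingleton_or_nontrivial (Fin M) with hM | hM
  · have h := kmeansF_le_of_forall_norm_sub_le (δ := 0) hρ hQ hx hdata hcenter m fun l k => by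
      simp [Subsingleton.elim l m]
    have hlam : 0 ≤ lapLam2 G := Real.sInf_nonneg fun _ hμ => lapMatrix_spectrum_nonneg G hμ.1
    have hgap : 0 ≤ 16 * Real.sqrt M * R ^ 2 * N ^ 2 / (ρ * lapLam2 G) := by positivity
    linarith
  have hlam := lapLam2_pos hconn
  have hM1 : (1 : ℝ) ≤ M := by exact_mod_cast Fin.pos m
  set c : Fin K → EuclideanSpace ℝ (Fin p) := fun k => (M : ℝ)⁻¹ • ∑ m, x m k with hc
  have hmean (k : Fin K) : ∑ m, (x m k - c k) = 0 := by
    rw [Finset.sum_sub_distrib, Finset.sum_const, Finset.card_univ, Fintype.card_fin, hc,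
      ← Nat.cast_smul_eq_nsmul ℝ, smul_smul, mul_inv_cancel₀ (by positivity), one_smul, sub_self]
  set S := Real.sqrt (∑ m, ∑ k, ‖x m k - c k‖ ^ 2) with hS
  have hS0 : 0 ≤ S := Real.sqrt_nonneg _
  have hS_sq : S ^ 2 = ∑ m, ∑ k, ‖x m k - c k‖ ^ 2 := Real.sq_sqrt (by positivity)
  have hdist (m : Fin M) (k : Fin K) : ‖x m k - c k‖ ≤ S := by
    refine Real.le_sqrt_of_sq_le ?_
    exact (Finset.single_le_sum (f := fun k => ‖x m k - c k‖ ^ 2)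
      (fun _ _ => by positivity) (Finset.mem_univ k)).trans
      (Finset.single_le_sum (f := fun m => ∑ k, ‖x m k - c k‖ ^ 2)
      (fun _ _ => by positivity) (Finset.mem_univ m))
  have hpoincare := lapLam2_mul_sum_norm_sq_le_dirichletEnergy hconn x hmean
  rw [← hS_sq] at hpoincare
  have henergy := dirichletEnergy_mul_le hρ hmin hR (fun m y hy => by
    linarith [norm_sub_le y (x m (j m y)), hdata m y hy, hcenter m y hy m]) hdist
  rw [← hN] at henergy
  have hSle : S * (ρ * lapLam2 G) ≤ 2 * R * N := by
    rcases hS0.eq_or_lt with h0 | hpos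
    · rw [← h0, zero_mul]
      exact mul_nonneg (by positivity) (Nat.cast_nonneg _)
    · refine le_of_mul_le_mul_right ?_ hpos
      nlinarith [mul_le_mul_of_nonneg_right hpoincare hρ.le]
  have hgap := kmeansF_le_of_forall_norm_sub_le (δ := 2 * S) hρ hQ hx hdata hcenter m
    fun l k => by
      have h := norm_sub_le (x l k - c k) (x m k - c k)
      rw [sub_sub_sub_cancel_right] at h
      linarith [hdist l k, hdist m k]
  refine hgap.trans (add_le_add_right ?_ _)
  rw [← hN, le_div_iff₀ (by positivity)]
  calc 4 * R * (2 * S) * N * (ρ * lapLam2 G)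
      = 8 * R * N * (S * (ρ * lapLam2 G)) := by ring
    _ ≤ 8 * R * N * (2 * R * N) := by gcongr
    _ = 16 * 1 * R ^ 2 * N ^ 2 := by ring
    _ ≤ 16 * Real.sqrt M * R ^ 2 * N ^ 2 := by
      gcongr
      exact Real.one_le_sqrt.2 hM1
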